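/- arXiv:1911.08840 — 9 statements merged into one kernel-verified Lean document; each statement's English description precedes it below -/
import Mathlib

section
/- Let A be an m×n real matrix with m < n, let s ≥ 1 and suppose δ ∈ [0,1) satisfies the 2s-restricted isometry inequality for A, i.e. (1−δ)·‖z‖₂² ≤ ‖Az‖₂² ≤ (1+δ)·‖z‖₂² for every vector z ∈ ℝⁿ with at most 2s nonzero entries. Let x ∈ ℝⁿ be supported on a set N ⊆ {1,…,n} with |N| ≤ s and put y := Ax. Then x is the unique minimizer of the 0-norm among solutions of the linear system: every z ∈ ℝⁿ with Az = y and z ≠ x satisfies ‖z‖₀ > ‖x‖₀. -/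
open Classical Finset

/-- The 0-norm: number of nonzero components of a vector. -/
noncomputable def norm0 {n : ℕ} (z : Fin n → ℝ) : ℕ :=
  (Finset.univ.filter fun i => z i ≠ 0).card

/-- The 1-norm of a vector. -/
noncomputable def norm1 {n : ℕ} (z : Fin n → ℝ) : ℝ := ∑ i, |z i|

/-- `δ` satisfies the `k`-restricted isometry inequality for `A`. -/
def RIPineq {m n : ℕ} (A : Matrix (Fin m) (Fin n) ℝ) (k : ℕ) (δ : ℝ) : Prop :=
  ∀ z : Fin n → ℝ, norm0 z ≤ k →
    (1 - δ) * (∑ i, z i ^ 2) ≤ ∑ j, (A.mulVec z j) ^ 2 ∧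
      ∑ j, (A.mulVec z j) ^ 2 ≤ (1 + δ) * (∑ i, z i ^ 2)

/-- `θ` satisfies the `(s,s')`-restricted orthogonality inequality for `A`. -/
def ROineq {m n : ℕ} (A : Matrix (Fin m) (Fin n) ℝ) (s s' : ℕ) (θ : ℝ) : Prop :=
  ∀ u v : Fin n → ℝ, (∀ i, u i = 0 ∨ v i = 0) → norm0 u ≤ s → norm0 v ≤ s' →
    |∑ j, A.mulVec u j * A.mulVec v j| ≤
      θ * Real.sqrt (∑ i, u i ^ 2) * Real.sqrt (∑ i, v i ^ 2)

/-- The restriction of `z` to the index set `S` (zero outside `S`). -/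
noncomputable def restrict {n : ℕ} (z : Fin n → ℝ) (S : Finset (Fin n)) : Fin n → ℝ :=
  fun i => if i ∈ S then z i else 0

theorem stmt_0 {m n : ℕ} (A : Matrix (Fin m) (Fin n) ℝ) (hmn : m < n)
    (s : ℕ) (hs : 1 ≤ s) (δ : ℝ) (hδ0 : 0 ≤ δ) (hδ1 : δ < 1)
    (hRIP : RIPineq A (2 * s) δ)
    (x : Fin n → ℝ) (N : Finset (Fin n)) (hsupp : ∀ i, i ∉ N → x i = 0)
    (hN : N.card ≤ s) (y : Fin m → ℝ) (hy : y = A.mulVec x) :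
    ∀ z : Fin n → ℝ, A.mulVec z = y → z ≠ x → norm0 x < norm0 z := by
  intro z hz hne
  by_contra hlt
  have hle : norm0 z ≤ norm0 x := Nat.le_of_not_lt hlt
  have hx : norm0 x ≤ s := by
    refine le_trans (Finset.card_le_card ?_) hN
    intro i hi
    by_contra hiN
    exact (Finset.mem_filter.mp hi).2 (hsupp i hiN)
  have hsub : norm0 (z - x) ≤ norm0 z + norm0 x := by
    refine le_trans (Finset.card_le_card ?_) (Finset.card_union_le _ _)
    intro i hi
    have h := (Finset.mem_filter.mp hi).2
    rw [Finset.mem_union, Finset.mem_filter, Finset.mem_filter]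
    by_cases h1 : z i = 0
    · right
      refine ⟨Finset.mem_univ _, fun h2 => h ?_⟩
      simp [h1, h2]
    · exact Or.inl ⟨Finset.mem_univ _, h1⟩
  have h := (hRIP (z - x) (by omega)).1
  have h0 : A.mulVec (z - x) = 0 := by
    rw [Matrix.mulVec_sub, hz, hy, sub_self]
  rw [h0] at h
  simp only [Pi.zero_apply, ne_eq, OfNat.ofNat_ne_zero, not_false_eq_true, zero_pow,
    Finset.sum_const_zero] at h
  have hnn : ∀ i ∈ (Finset.univ : Finset (Fin n)), 0 ≤ (z - x) i ^ 2 := fun i _ => sq_nonneg _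
  have hsum : ∑ i, (z - x) i ^ 2 = 0 := by
    have := Finset.sum_nonneg hnn
    nlinarith
  apply hne
  funext i
  have hi := (Finset.sum_eq_zero_iff_of_nonneg hnn).mp hsum i (Finset.mem_univ i)
  have hi2 : (z - x) i = 0 := by simpa using hi
  exact sub_eq_zero.mp hi2
end

section
/- Let A be an m×n real matrix with m < n and s ≥ 1. Suppose δ ≥ 0 satisfies the s-restricted isometry inequality for A, θ₁ ≥ 0 satisfies the (s,s)-restricted orthogonality inequality for A, θ₂ ≥ 0 satisfies the (s,2s)-restricted orthogonality inequality for A, and δ + θ₁ + θ₂ < 1. Let x ∈ ℝⁿ be supported on a set N ⊆ {1,…,n} with |N| ≤ s and put y := Ax. Then x is the unique minimizer of the 1-norm among solutions of the linear system: every z ∈ ℝⁿ with Az = y and z ≠ x satisfies ‖z‖₁ > ‖x‖₁. -/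
open Classical Finset

/-- Existence of a set of `k` largest entries, with a threshold. -/
theorem exists_top {ι : Type*} [DecidableEq ι] (f : ι → ℝ) (S : Finset ι) (k : ℕ) (hk : k ≤ S.card) :
    ∃ T ⊆ S, T.card = k ∧ ∀ i ∈ T, ∀ j ∈ S \ T, f j ≤ f i := by
  induction k with
  | zero => exact ⟨∅, by simp, by simp, by simp⟩
  | succ k ih =>
    obtain ⟨T, hTS, hc, hT⟩ := ih (by omega)
    have hne : (S \ T).Nonempty := by
      rw [← Finset.card_pos, Finset.card_sdiff_of_subset hTS]; omega
    obtain ⟨a, ha, hmax⟩ := Finset.exists_max_image (S \ T) f hne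
    have ha' := Finset.mem_sdiff.1 ha
    refine ⟨insert a T, ?_, ?_, ?_⟩
    · intro i hi
      rcases Finset.mem_insert.1 hi with rfl | hi
      · exact ha'.1
      · exact hTS hi
    · rw [Finset.card_insert_of_notMem ha'.2, hc]
    · intro i hi j hj
      have hj' : j ∈ S \ T := by
        simp only [Finset.mem_sdiff, Finset.mem_insert, not_or] at hj ⊢
        exact ⟨hj.1, hj.2.2⟩
      rcases Finset.mem_insert.1 hi with rfl | hi
      · exact hmax j hj'
      · exact hT i hi j hj'

theorem exists_top_thr {ι : Type*} [DecidableEq ι] (f : ι → ℝ) (hf : ∀ i, 0 ≤ f i) (S : Finset ι)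
    (k : ℕ) (hk1 : 1 ≤ k) (hk : k ≤ S.card) :
    ∃ T ⊆ S, T.card = k ∧ ∃ M : ℝ, 0 ≤ M ∧ (∀ i ∈ T, M ≤ f i) ∧ ∀ j ∈ S \ T, f j ≤ M := by
  obtain ⟨T, hTS, hc, hT⟩ := exists_top f S k hk
  have hne : T.Nonempty := by rw [← Finset.card_pos]; omega
  obtain ⟨a, ha, hmin⟩ := Finset.exists_min_image T f hne
  exact ⟨T, hTS, hc, f a, hf a, hmin, fun j hj => hT a ha j hj⟩

theorem sqrt_sum_le {ι : Type*} (f : ι → ℝ) (hf : ∀ i, 0 ≤ f i) (T : Finset ι) (s : ℕ)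
    (hT : T.card ≤ s) (M : ℝ) (hM0 : 0 ≤ M) (hM : ∀ i ∈ T, f i ≤ M) :
    Real.sqrt (∑ i ∈ T, f i ^ 2) ≤ Real.sqrt s * M := by
  have h1 : ∑ i ∈ T, f i ^ 2 ≤ s * M ^ 2 := by
    calc ∑ i ∈ T, f i ^ 2 ≤ ∑ i ∈ T, M ^ 2 :=
          Finset.sum_le_sum fun i hi => pow_le_pow_left₀ (hf i) (hM i hi) 2
      _ = T.card * M ^ 2 := by simp
      _ ≤ s * M ^ 2 := by gcongr
  calc Real.sqrt (∑ i ∈ T, f i ^ 2) ≤ Real.sqrt (s * M ^ 2) := Real.sqrt_le_sqrt h1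
    _ = Real.sqrt s * M := by rw [Real.sqrt_mul (by positivity), Real.sqrt_sq hM0]

/-- The block decomposition estimate. -/
theorem block_bound {ι : Type*} [DecidableEq ι] (f : ι → ℝ) (hf : ∀ i, 0 ≤ f i)
    (B : Finset ι → ℝ) (c : ℝ) (hc : 0 ≤ c) (s : ℕ) (hs : 1 ≤ s) (S₀ : Finset ι)
    (hadd : ∀ T S, T ⊆ S → B S = B T + B (S \ T))
    (hB : ∀ T ⊆ S₀, T.card ≤ s → |B T| ≤ c * Real.sqrt (∑ i ∈ T, f i ^ 2)) :
    ∀ (k : ℕ) (S : Finset ι), S.card ≤ k → S ⊆ S₀ → ∀ M : ℝ, 0 ≤ M → (∀ i ∈ S, f i ≤ M) →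
      |B S| ≤ c * (Real.sqrt s * M + (∑ i ∈ S, f i) / Real.sqrt s) := by
  have hs0 : (0 : ℝ) < s := by exact_mod_cast hs
  have hr : 0 < Real.sqrt s := Real.sqrt_pos.2 hs0
  intro k
  induction k with
  | zero =>
    intro S hS hS0 M hM0 hM
    refine (hB S hS0 (by omega)).trans ?_
    have := sqrt_sum_le f hf S s (by omega) M hM0 hM
    have h2 : 0 ≤ (∑ i ∈ S, f i) / Real.sqrt s := div_nonneg (Finset.sum_nonneg fun i _ => hf i) hr.le
    exact mul_le_mul_of_nonneg_left (by linarith) hc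
  | succ k ih =>
    intro S hS hS0 M hM0 hM
    by_cases hle : S.card ≤ s
    · refine (hB S hS0 hle).trans ?_
      have := sqrt_sum_le f hf S s hle M hM0 hM
      have h2 : 0 ≤ (∑ i ∈ S, f i) / Real.sqrt s :=
        div_nonneg (Finset.sum_nonneg fun i _ => hf i) hr.le
      exact mul_le_mul_of_nonneg_left (by linarith) hc
    · obtain ⟨T, hTS, hTc, M', hM'0, hT1, hT2⟩ := exists_top_thr f hf S s hs (by omega)
      have h1 := ih (S \ T) (by rw [Finset.card_sdiff_of_subset hTS]; omega)
        (Finset.sdiff_subset.trans hS0) M' hM'0 hT2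
      have h2 := hB T (hTS.trans hS0) hTc.le
      have h3 := sqrt_sum_le f hf T s hTc.le M hM0 fun i hi => hM i (hTS hi)
      have h4 : s * M' ≤ ∑ i ∈ T, f i := by
        have := Finset.card_nsmul_le_sum T f M' hT1
        rwa [hTc, nsmul_eq_mul] at this
      have h5 : Real.sqrt s * M' ≤ (∑ i ∈ T, f i) / Real.sqrt s := by
        rw [le_div_iff₀ hr]
        nlinarith [Real.mul_self_sqrt hs0.le]
      have h6 : ∑ i ∈ S, f i = ∑ i ∈ T, f i + ∑ i ∈ S \ T, f i := by
        rw [add_comm]; exact (Finset.sum_sdiff hTS).symm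
      rw [hadd T S hTS, h6, add_div]
      refine (abs_add_le _ _).trans ?_
      have h7 := mul_le_mul_of_nonneg_left h3 hc
      have h8 := mul_le_mul_of_nonneg_left h5 hc
      nlinarith

theorem norm0_restrict_le {n : ℕ} (z : Fin n → ℝ) (S : Finset (Fin n)) :
    norm0 (restrict z S) ≤ S.card := by
  unfold norm0 _root_.restrict
  apply Finset.card_le_card
  intro i hi
  by_contra h
  simp [h] at hi

theorem sum_restrict_sq {n : ℕ} (z : Fin n → ℝ) (S : Finset (Fin n)) :
    ∑ i, restrict z S i ^ 2 = ∑ i ∈ S, |z i| ^ 2 := by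
  simp [_root_.restrict, ite_pow, Finset.sum_ite_mem]

theorem stmt_1 {m n : ℕ} (A : Matrix (Fin m) (Fin n) ℝ) (hmn : m < n)
    (s : ℕ) (hs : 1 ≤ s) (δ θ₁ θ₂ : ℝ)
    (hδ0 : 0 ≤ δ) (hθ₁0 : 0 ≤ θ₁) (hθ₂0 : 0 ≤ θ₂)
    (hRIP : RIPineq A s δ)
    (hRO1 : ROineq A s s θ₁)
    (hRO2 : ROineq A s (2 * s) θ₂)
    (hsum : δ + θ₁ + θ₂ < 1)
    (x : Fin n → ℝ) (N : Finset (Fin n)) (hsupp : ∀ i, i ∉ N → x i = 0)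
    (hN : N.card ≤ s) (y : Fin m → ℝ) (hy : y = A.mulVec x) :
    ∀ z : Fin n → ℝ, A.mulVec z = y → z ≠ x → norm1 x < norm1 z := by
  intro z hz hzx
  by_contra hcon
  push Not at hcon
  apply hzx
  set h : Fin n → ℝ := z - x with hh
  have hAh : A.mulVec h = 0 := by rw [hh, Matrix.mulVec_sub, hz, hy, sub_self]
  have hs0 : (0 : ℝ) < s := by exact_mod_cast hs
  have hr : 0 < Real.sqrt s := Real.sqrt_pos.2 hs0
  suffices hzero : ∀ i, |h i| = 0 by
    funext i
    have := abs_eq_zero.1 (hzero i)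
    simp only [hh, Pi.sub_apply] at this
    linarith
  by_cases hns : n ≤ s
  · have h1 := (hRIP h ((Finset.card_le_univ _).trans (by simpa using hns))).1
    rw [hAh] at h1
    simp only [Pi.zero_apply, ne_eq, OfNat.ofNat_ne_zero, not_false_eq_true, zero_pow,
      Finset.sum_const_zero] at h1
    have h0 : 0 ≤ ∑ i, h i ^ 2 := Finset.sum_nonneg fun i _ => sq_nonneg _
    have h2 : ∑ i, h i ^ 2 = 0 := by nlinarith
    intro i
    have := (Finset.sum_eq_zero_iff_of_nonneg (fun i _ => sq_nonneg (h i))).1 h2 i (Finset.mem_univ i)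
    simpa using this
  · obtain ⟨T, -, hTc, M, hM0, hT1, hT2⟩ :=
      exists_top_thr (fun i => |h i|) (fun i => abs_nonneg _) Finset.univ s hs (by simp; omega)
    have hT2 : ∀ j, j ∉ T → |h j| ≤ M := fun j hj => hT2 j (by simp [hj])
    -- null space property
    have hNT : ∑ i ∈ N, |h i| ≤ ∑ i ∈ T, |h i| := by
      have hcard : (N \ T).card ≤ (T \ N).card := by
        have e1 := Finset.card_sdiff_add_card_inter N T
        have e2 := Finset.card_sdiff_add_card_inter T N
        rw [Finset.inter_comm] at e2
        omega
      have a1 : ∑ i ∈ N \ T, |h i| ≤ (N \ T).card * M := by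
        have := Finset.sum_le_card_nsmul (N \ T) (fun i => |h i|) M
          fun i hi => hT2 i (Finset.mem_sdiff.1 hi).2
        rwa [nsmul_eq_mul] at this
      have a2 : (T \ N).card * M ≤ ∑ i ∈ T \ N, |h i| := by
        have := Finset.card_nsmul_le_sum (T \ N) (fun i => |h i|) M
          fun i hi => hT1 i (Finset.mem_sdiff.1 hi).1
        rwa [nsmul_eq_mul] at this
      have a3 : ((N \ T).card : ℝ) * M ≤ (T \ N).card * M := by gcongr
      have b1 := Finset.sum_inter_add_sum_sdiff N T (fun i => |h i|)
      have b2 := Finset.sum_inter_add_sum_sdiff T N (fun i => |h i|)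
      rw [Finset.inter_comm] at b2
      linarith
    have hsplit : ∀ (g : Fin n → ℝ) (S : Finset (Fin n)),
        ∑ i, g i = ∑ i ∈ S, g i + ∑ i ∈ Sᶜ, g i := fun g S => (Finset.sum_add_sum_compl S g).symm
    have hcone : ∑ i ∈ Nᶜ, |h i| ≤ ∑ i ∈ N, |h i| := by
      unfold norm1 at hcon
      rw [hsplit (fun i => |z i|) N, hsplit (fun i => |x i|) N] at hcon
      have c1 : ∑ i ∈ Nᶜ, |x i| = 0 := Finset.sum_eq_zero fun i hi => by
        rw [hsupp i (Finset.mem_compl.1 hi), abs_zero]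
      have c2 : ∑ i ∈ Nᶜ, |z i| = ∑ i ∈ Nᶜ, |h i| := Finset.sum_congr rfl fun i hi => by
        rw [hh, Pi.sub_apply, hsupp i (Finset.mem_compl.1 hi), sub_zero]
      have c3 : ∑ i ∈ N, |x i| ≤ ∑ i ∈ N, |z i| + ∑ i ∈ N, |h i| := by
        rw [← Finset.sum_add_distrib]
        refine Finset.sum_le_sum fun i _ => ?_
        have := abs_sub_abs_le_abs_sub (x i) (z i)
        rw [abs_sub_comm] at this
        simp only [hh, Pi.sub_apply]
        linarith
      linarith
    have hTcone : ∑ i ∈ Tᶜ, |h i| ≤ ∑ i ∈ T, |h i| := by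
      have d1 := hsplit (fun i => |h i|) N
      have d2 := hsplit (fun i => |h i|) T
      linarith
    -- norms
    set P : ℝ := Real.sqrt (∑ i ∈ T, |h i| ^ 2) with hP
    have hP0 : 0 ≤ P := Real.sqrt_nonneg _
    have hPsq : P ^ 2 = ∑ i ∈ T, |h i| ^ 2 :=
      Real.sq_sqrt (Finset.sum_nonneg fun i _ => sq_nonneg _)
    have hMP : Real.sqrt s * M ≤ P := by
      rw [hP]
      apply Real.le_sqrt_of_sq_le
      rw [mul_pow, Real.sq_sqrt hs0.le]
      have := Finset.card_nsmul_le_sum T (fun i => |h i| ^ 2) (M ^ 2)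
        fun i hi => pow_le_pow_left₀ hM0 (hT1 i hi) 2
      rwa [hTc, nsmul_eq_mul] at this
    have hl1 : (∑ i ∈ T, |h i|) / Real.sqrt s ≤ P := by
      rw [div_le_iff₀ hr, hP, ← Real.sqrt_mul (Finset.sum_nonneg fun i _ => sq_nonneg _)]
      apply Real.le_sqrt_of_sq_le
      have := sq_sum_le_card_mul_sum_sq (s := T) (f := fun i => |h i|)
      rw [hTc] at this
      linarith
    set θ := min θ₁ θ₂ with hθ
    have hθ0 : 0 ≤ θ := le_min hθ₁0 hθ₂0
    set B : Finset (Fin n) → ℝ := fun S =>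
      ∑ j, A.mulVec (restrict h T) j * A.mulVec (restrict h S) j with hBdef
    have hadd : ∀ R S : Finset (Fin n), R ⊆ S → B S = B R + B (S \ R) := by
      intro R S hRS
      have : restrict h S = restrict h R + restrict h (S \ R) := by
        funext i
        have := @hRS i
        by_cases h1 : i ∈ R <;> by_cases h2 : i ∈ S <;> simp_all [_root_.restrict]
      simp only [hBdef]
      rw [this, Matrix.mulVec_add, ← Finset.sum_add_distrib]
      exact Finset.sum_congr rfl fun j _ => by simp only [Pi.add_apply]; ring
    have hB : ∀ R ⊆ Tᶜ, R.card ≤ s → |B R| ≤ θ * P * Real.sqrt (∑ i ∈ R, |h i| ^ 2) := by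
      intro R hR hRc
      have hdis : ∀ i, restrict h T i = 0 ∨ restrict h R i = 0 := by
        intro i
        by_cases hi : i ∈ T
        · right
          have : i ∉ R := fun hiR => Finset.mem_compl.1 (hR hiR) hi
          simp [_root_.restrict, this]
        · left; simp [_root_.restrict, hi]
      have n1 := (norm0_restrict_le h T).trans hTc.le
      have n2 := (norm0_restrict_le h R).trans hRc
      have e1 := hRO1 _ _ hdis n1 n2
      have e2 := hRO2 _ _ hdis n1 (by omega)
      rw [sum_restrict_sq, sum_restrict_sq] at e1 e2
      rcases min_choice θ₁ θ₂ with hm | hm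
      · rw [hθ, hm]; exact e1
      · rw [hθ, hm]; exact e2
    have key := block_bound (fun i => |h i|) (fun i => abs_nonneg _) B (θ * P) (by positivity) s hs
      Tᶜ hadd hB _ Tᶜ le_rfl subset_rfl M hM0 fun i hi => hT2 i (Finset.mem_compl.1 hi)
    have hBuniv : B Finset.univ = 0 := by
      have : restrict h Finset.univ = h := by funext i; simp [_root_.restrict]
      simp only [hBdef]
      rw [this, hAh]; simp
    have hBT : (1 - δ) * P ^ 2 ≤ B T := by
      have := (hRIP _ ((norm0_restrict_le h T).trans hTc.le)).1
      rw [sum_restrict_sq, ← hPsq] at this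
      simpa only [hBdef, ← sq] using this
    have hsum0 := hadd T Finset.univ (Finset.subset_univ _)
    rw [hBuniv, ← Finset.compl_eq_univ_sdiff] at hsum0
    have hfin : (∑ i ∈ Tᶜ, |h i|) / Real.sqrt s ≤ P :=
      (div_le_div_of_nonneg_right hTcone hr.le).trans hl1
    have hub : |B Tᶜ| ≤ θ * P * (P + P) :=
      key.trans (mul_le_mul_of_nonneg_left (add_le_add hMP hfin) (by positivity))
    have hneg := neg_abs_le (B Tᶜ)
    have ht : 2 * θ ≤ θ₁ + θ₂ := by
      have := min_le_left θ₁ θ₂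
      have := min_le_right θ₁ θ₂
      linarith
    have hPz : P ^ 2 = 0 := by
      have : 0 < 1 - δ - 2 * θ := by linarith
      have h3 : (1 - δ - 2 * θ) * P ^ 2 ≤ 0 := by nlinarith
      nlinarith [sq_nonneg P]
    have hPz' : P = 0 := by simpa using hPz
    have hMz : M = 0 := by
      rw [hPz'] at hMP
      nlinarith
    intro i
    by_cases hi : i ∈ T
    · rw [hPz] at hPsq
      have := (Finset.sum_eq_zero_iff_of_nonneg (fun i _ => sq_nonneg (|h i|))).1 hPsq.symm i hi
      simpa using this
    · exact le_antisymm (hMz ▸ hT2 i hi) (abs_nonneg _)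
end

section
/- Let A be an m×n real matrix with m < n. Let x ∈ ℝⁿ be a sparse vector with support N = (T ∪ Δ) \ Δₑ, where T ⊆ {1,…,n} is a known set with |T| = k, Δ ⊆ {1,…,n} is disjoint from T with |Δ| = u, and Δₑ ⊆ T. Put y := Ax. If δ ∈ [0,1) satisfies the (k+2u)-restricted isometry inequality for A, then x is the unique minimizer of ‖z_{T^c}‖₀ subject to Az = y: every z ∈ ℝⁿ with Az = y and z ≠ x satisfies ‖z_{T^c}‖₀ > ‖x_{T^c}‖₀. -/
open Classical Finset

theorem stmt_3 {m n : ℕ} (A : Matrix (Fin m) (Fin n) ℝ) (hmn : m < n)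
    (x : Fin n → ℝ) (N T Δ Δe : Finset (Fin n)) (k u : ℕ)
    (hTk : T.card = k) (hΔu : Δ.card = u) (hdisj : Disjoint T Δ) (hΔe : Δe ⊆ T)
    (hNdef : N = (T ∪ Δ) \ Δe)
    (hsupp : ∀ i, x i ≠ 0 ↔ i ∈ N)
    (y : Fin m → ℝ) (hy : y = A.mulVec x)
    (δ : ℝ) (hδ0 : 0 ≤ δ) (hδ1 : δ < 1)
    (hRIP : RIPineq A (k + 2 * u) δ) :
    ∀ z : Fin n → ℝ, A.mulVec z = y → z ≠ x →
      norm0 (restrict x Tᶜ) < norm0 (restrict z Tᶜ) := by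
  intro z hz hne
  by_contra hlt
  rw [not_lt] at hlt
  have hxu : norm0 (restrict x Tᶜ) ≤ u := by
    rw [← hΔu]
    apply Finset.card_le_card
    intro i hi
    simp only [_root_.restrict, Finset.mem_filter, Finset.mem_univ, true_and, Finset.mem_compl,
      ne_eq, ite_eq_right_iff, Classical.not_imp] at hi
    have h := (hsupp i).1 hi.2
    rw [hNdef, Finset.mem_sdiff, Finset.mem_union] at h
    tauto
  have hsub : (Finset.univ.filter fun i => (z - x) i ≠ 0) ⊆
      T ∪ ((Finset.univ.filter fun i => restrict x Tᶜ i ≠ 0) ∪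
        (Finset.univ.filter fun i => restrict z Tᶜ i ≠ 0)) := by
    intro i hi
    simp only [_root_.restrict, Finset.mem_filter, Finset.mem_univ, true_and, Finset.mem_compl,
      ne_eq, ite_eq_right_iff, Classical.not_imp, Finset.mem_union, Pi.sub_apply] at hi ⊢
    by_contra hc
    apply hi
    have h1 : x i = 0 := by tauto
    have h2 : z i = 0 := by tauto
    rw [h1, h2, sub_zero]
  have hcard : norm0 (z - x) ≤ k + 2 * u := by
    have h1 := Finset.card_le_card hsub
    have h2 := Finset.card_union_le T ((Finset.univ.filter fun i => restrict x Tᶜ i ≠ 0) ∪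
        (Finset.univ.filter fun i => restrict z Tᶜ i ≠ 0))
    have h3 := Finset.card_union_le (Finset.univ.filter fun i => restrict x Tᶜ i ≠ 0)
        (Finset.univ.filter fun i => restrict z Tᶜ i ≠ 0)
    unfold norm0 at hlt hxu ⊢
    omega
  have h := (hRIP (z - x) hcard).1
  have hA : A.mulVec (z - x) = 0 := by
    rw [Matrix.mulVec_sub, hz, hy, sub_self]
  rw [hA] at h
  simp only [Pi.zero_apply, ne_eq, OfNat.ofNat_ne_zero, not_false_eq_true, zero_pow,
    Finset.sum_const_zero] at h
  have hnn : 0 ≤ ∑ i, (z - x) i ^ 2 := Finset.sum_nonneg fun i _ => sq_nonneg _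
  have h0 : ∑ i, (z - x) i ^ 2 = 0 := by nlinarith
  apply hne
  funext i
  have hi := (Finset.sum_eq_zero_iff_of_nonneg (fun i _ => sq_nonneg ((z - x) i))).1 h0 i
    (Finset.mem_univ i)
  exact sub_eq_zero.1 (pow_eq_zero_iff two_ne_zero |>.1 hi)
end

section
/- Let A be an m×n real matrix with m < n, let x ∈ ℝⁿ be supported on N ⊆ {1,…,n} with |N| = s, and put y := Ax. Let T ⊆ {1,…,n} with |T| = k, let Δ₁ = T ∩ N with |Δ₁| = t, and Δ = T^c ∩ N with |Δ| = u. Fix w ∈ [0,1]. If some δ ∈ [0,1) satisfies the (k + 2u + ⌈w·t⌉)-restricted isometry inequality for A, then x is the unique minimizer of the weighted 0-norm ‖z‖₀,w := w·‖z_T‖₀ + ‖z_{T^c}‖₀ subject to Az = y: every z ∈ ℝⁿ with Az = y and z ≠ x satisfies ‖z‖₀,w > ‖x‖₀,w. -/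
open Classical Finset

theorem stmt_6 {m n : ℕ} (A : Matrix (Fin m) (Fin n) ℝ) (hmn : m < n)
    (x : Fin n → ℝ) (N T : Finset (Fin n)) (s k t u : ℕ)
    (hsupp : ∀ i, i ∉ N → x i = 0) (hNs : N.card = s)
    (hTk : T.card = k) (ht : (T ∩ N).card = t) (hu : (Tᶜ ∩ N).card = u)
    (w : ℝ) (hw0 : 0 ≤ w) (hw1 : w ≤ 1)
    (y : Fin m → ℝ) (hy : y = A.mulVec x)
    (δ : ℝ) (hδ0 : 0 ≤ δ) (hδ1 : δ < 1)
    (hRIP : RIPineq A (k + 2 * u + ⌈w * (t : ℝ)⌉₊) δ) :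
    ∀ z : Fin n → ℝ, A.mulVec z = y → z ≠ x →
      w * (norm0 (restrict x T) : ℝ) + (norm0 (restrict x Tᶜ) : ℝ) <
        w * (norm0 (restrict z T) : ℝ) + (norm0 (restrict z Tᶜ) : ℝ) := by
  intro z hz hne
  by_contra hcon
  push Not at hcon
  have h1 : norm0 (restrict x T) ≤ t := by
    rw [← ht]
    unfold norm0 _root_.restrict
    apply Finset.card_le_card
    intro i hi
    simp only [Finset.mem_filter, Finset.mem_univ, true_and, Finset.mem_inter] at hi ⊢
    by_cases hT : i ∈ T
    · refine ⟨hT, ?_⟩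
      by_contra hN
      simp [hsupp i hN] at hi
    · simp [hT] at hi
  have h2 : norm0 (restrict x Tᶜ) ≤ u := by
    rw [← hu]
    unfold norm0 _root_.restrict
    apply Finset.card_le_card
    intro i hi
    simp only [Finset.mem_filter, Finset.mem_univ, true_and, Finset.mem_inter] at hi ⊢
    by_cases hT : i ∈ Tᶜ
    · refine ⟨hT, ?_⟩
      by_contra hN
      simp [hsupp i hN] at hi
    · simp only [hT, if_false] at hi
      exact absurd rfl hi
  have h3 : norm0 (restrict z Tᶜ) ≤ u + ⌈w * (t : ℝ)⌉₊ := by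
    have h1' : (norm0 (restrict x T) : ℝ) ≤ t := by exact_mod_cast h1
    have h2' : (norm0 (restrict x Tᶜ) : ℝ) ≤ u := by exact_mod_cast h2
    have h4 := mul_le_mul_of_nonneg_left h1' hw0
    have h5 : 0 ≤ w * (norm0 (restrict z T) : ℝ) := by positivity
    have h6 := Nat.le_ceil (w * (t : ℝ))
    have h7 : (norm0 (restrict z Tᶜ) : ℝ) ≤ u + (⌈w * (t : ℝ)⌉₊ : ℝ) := by linarith
    exact_mod_cast h7
  have h4 : norm0 (z - x) ≤ k + 2 * u + ⌈w * (t : ℝ)⌉₊ := by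
    have hsub : (Finset.univ.filter fun i => (z - x) i ≠ 0) ⊆
        (T ∪ (Tᶜ ∩ N)) ∪ (Finset.univ.filter fun i => restrict z Tᶜ i ≠ 0) := by
      intro i hi
      simp only [Finset.mem_filter, Finset.mem_univ, true_and, Finset.mem_union,
        Finset.mem_inter, Finset.mem_compl, _root_.restrict, Pi.sub_apply] at hi ⊢
      by_cases hT : i ∈ T
      · exact Or.inl (Or.inl hT)
      · by_cases hN : i ∈ N
        · exact Or.inl (Or.inr ⟨hT, hN⟩)
        · right
          rw [hsupp i hN, sub_zero] at hi
          simpa [hT] using hi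
    have c1 := Finset.card_le_card hsub
    have c2 := Finset.card_union_le (T ∪ (Tᶜ ∩ N))
      (Finset.univ.filter fun i => restrict z Tᶜ i ≠ 0)
    have c3 := Finset.card_union_le T (Tᶜ ∩ N)
    unfold norm0 at h3 ⊢
    omega
  have h5 := (hRIP (z - x) h4).1
  have h6 : A.mulVec (z - x) = 0 := by
    rw [Matrix.mulVec_sub, hz, hy, sub_self]
  rw [h6] at h5
  simp only [Pi.zero_apply, ne_eq, OfNat.ofNat_ne_zero, not_false_eq_true, zero_pow,
    Finset.sum_const_zero] at h5
  have h7 : ∑ i, (z - x) i ^ 2 = 0 := by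
    have h8 : 0 ≤ ∑ i, (z - x) i ^ 2 := Finset.sum_nonneg fun i _ => sq_nonneg _
    nlinarith
  rw [Finset.sum_eq_zero_iff_of_nonneg (fun i _ => sq_nonneg _)] at h7
  apply hne
  funext i
  have h9 := pow_eq_zero_iff (two_ne_zero) |>.1 (h7 i (Finset.mem_univ i))
  simpa [sub_eq_zero] using h9
end

section
/- Let x ∈ ℝⁿ be supported on N with |N| = s, let T ⊆ {1,…,n} with |T| = k, let Δ = T^c ∩ N with |Δ| = u, let w ∈ [0,1], and let A be an m×n real matrix with m < n. Let z̃ be any minimizer of the weighted 0-norm ‖z‖₀,w := w·‖z_T‖₀ + ‖z_{T^c}‖₀ over {z : Az = Ax}. Then ‖z̃_{T^c}‖₀ ≤ w·t + u, where t = |T ∩ N|; in particular, the support of z̃ − x is contained in a set of cardinality at most k + 2u + w·t, namely T ∪ Δ ∪ Δ̃ where Δ̃ is the support of z̃ outside T. -/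
open Classical Finset

theorem stmt_7 {m n : ℕ} (A : Matrix (Fin m) (Fin n) ℝ) (hmn : m < n)
    (x : Fin n → ℝ) (N T : Finset (Fin n)) (s k t u : ℕ)
    (hsupp : ∀ i, i ∉ N → x i = 0) (hNs : N.card = s)
    (hTk : T.card = k) (ht : (T ∩ N).card = t) (hu : (Tᶜ ∩ N).card = u)
    (w : ℝ) (hw0 : 0 ≤ w) (hw1 : w ≤ 1)
    (zt : Fin n → ℝ)
    (hfeas : A.mulVec zt = A.mulVec x)
    (hmin : ∀ z : Fin n → ℝ, A.mulVec z = A.mulVec x →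
      w * (norm0 (restrict zt T) : ℝ) + (norm0 (restrict zt Tᶜ) : ℝ) ≤
        w * (norm0 (restrict z T) : ℝ) + (norm0 (restrict z Tᶜ) : ℝ)) :
    (norm0 (restrict zt Tᶜ) : ℝ) ≤ w * (t : ℝ) + (u : ℝ) ∧
    (∀ i, zt i - x i ≠ 0 →
      i ∈ T ∪ (Tᶜ ∩ N) ∪ (Finset.univ.filter fun i => zt i ≠ 0 ∧ i ∉ T)) ∧
    ((T ∪ (Tᶜ ∩ N) ∪ (Finset.univ.filter fun i => zt i ≠ 0 ∧ i ∉ T)).card : ℝ) ≤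
      (k : ℝ) + 2 * (u : ℝ) + w * (t : ℝ) := by
  have h1 : norm0 (restrict x T) ≤ t := by
    rw [← ht]
    unfold norm0 _root_.restrict
    apply Finset.card_le_card
    intro i hi
    have := hsupp i
    simp at hi ⊢
    tauto
  have h2 : norm0 (restrict x Tᶜ) ≤ u := by
    rw [← hu]
    unfold norm0 _root_.restrict
    apply Finset.card_le_card
    intro i hi
    have := hsupp i
    simp at hi ⊢
    tauto
  have h3 : (Finset.univ.filter fun i => zt i ≠ 0 ∧ i ∉ T).card = norm0 (restrict zt Tᶜ) := by
    unfold norm0 _root_.restrict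
    congr 1
    ext i
    simp
    tauto
  have hA : (norm0 (restrict zt Tᶜ) : ℝ) ≤ w * (t : ℝ) + (u : ℝ) := by
    have h := hmin x rfl
    have h1' : (norm0 (restrict x T) : ℝ) ≤ t := by exact_mod_cast h1
    have h2' : (norm0 (restrict x Tᶜ) : ℝ) ≤ u := by exact_mod_cast h2
    have h4 := mul_le_mul_of_nonneg_left h1' hw0
    have h5 : 0 ≤ w * (norm0 (restrict zt T) : ℝ) := by positivity
    linarith
  refine ⟨hA, ?_, ?_⟩
  · intro i hi
    have := hsupp i
    by_cases hT : i ∈ T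
    · simp [hT]
    · by_cases hN : i ∈ N
      · simp [hT, hN]
      · rw [this hN, sub_zero] at hi
        simp [hT, hi]
  · have c1 := Finset.card_union_le (T ∪ (Tᶜ ∩ N)) (Finset.univ.filter fun i => zt i ≠ 0 ∧ i ∉ T)
    have c2 := Finset.card_union_le T (Tᶜ ∩ N)
    rw [h3] at c1
    have c3 : (T ∪ (Tᶜ ∩ N) ∪ (Finset.univ.filter fun i => zt i ≠ 0 ∧ i ∉ T)).card ≤
        k + u + norm0 (restrict zt Tᶜ) := by omega
    have c4 : ((T ∪ (Tᶜ ∩ N) ∪ (Finset.univ.filter fun i => zt i ≠ 0 ∧ i ∉ T)).card : ℝ) ≤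
        k + u + norm0 (restrict zt Tᶜ) := by exact_mod_cast c3
    linarith
end

section
/- Let A be an m×n real matrix with m < n and columns a₁,…,aₙ. Let x ∈ ℝⁿ be supported on N ⊆ {1,…,n} with |N| = s, let T ⊆ {1,…,n} with |T| = k, let Δ = T^c ∩ N with |Δ| = u, and let w ∈ [0,1]. Define c ∈ ℝⁿ by cᵢ = w·sgn(xᵢ) for i ∈ T, cᵢ = sgn(xᵢ) for i ∈ Δ, and cᵢ = 0 otherwise. Suppose δ ≥ 0 satisfies the (k+u)-restricted isometry inequality for A, θ₁ ≥ 0 satisfies the (k+u, k+u)-restricted orthogonality inequality for A, θ₂ ≥ 0 satisfies the (k+u, 2(k+u))-restricted orthogonality inequality for A, and √((k·w² + u)/(k + u))·θ₁ + δ + θ₂ < 1. Then there exists γ ∈ ℝᵐ such that ⟨γ, aᵢ⟩ = w·sgn(xᵢ) for i ∈ T, ⟨γ, aᵢ⟩ = sgn(xᵢ) for i ∈ Δ, and |⟨γ, aᵢ⟩| < 1 for i ∈ (T ∪ Δ)^c. -/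
open Classical Finset

theorem aux_top {n : ℕ} (f : Fin n → ℝ) (U : Finset (Fin n)) (t : ℕ) (ht : t ≤ U.card) :
    ∃ V ⊆ U, V.card = t ∧ ∀ i ∈ V, ∀ j ∈ U \ V, f j ≤ f i := by
  induction t with
  | zero => exact ⟨∅, by simp, by simp, by simp⟩
  | succ t ih =>
    obtain ⟨V, hVU, hVc, hV⟩ := ih (by omega)
    have hne : (U \ V).Nonempty := by
      rw [← Finset.card_pos, Finset.card_sdiff_of_subset hVU]; omega
    obtain ⟨m, hm, hmax⟩ := Finset.exists_max_image (U \ V) f hne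
    have hm' := Finset.mem_sdiff.1 hm
    refine ⟨insert m V, ?_, ?_, ?_⟩
    · intro i hi
      rcases Finset.mem_insert.1 hi with rfl | hi
      · exact hm'.1
      · exact hVU hi
    · rw [Finset.card_insert_of_notMem hm'.2, hVc]
    · intro i hi j hj
      have hj' : j ∈ U \ V := by
        simp only [Finset.mem_sdiff, Finset.mem_insert, not_or] at hj ⊢
        exact ⟨hj.1, hj.2.2⟩
      rcases Finset.mem_insert.1 hi with rfl | hi
      · exact hmax j hj'
      · exact hV i hi j hj'

theorem aux_norm0 {n : ℕ} (h : Fin n → ℝ) (U : Finset (Fin n)) :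
    norm0 (restrict h U) ≤ U.card := by
  apply Finset.card_le_card
  intro i hi
  by_contra hU
  simp [_root_.restrict, hU] at hi

theorem aux_sq {n : ℕ} (h : Fin n → ℝ) (U : Finset (Fin n)) :
    ∑ i, restrict h U i ^ 2 = ∑ i ∈ U, h i ^ 2 := by
  simp [_root_.restrict, ite_pow, Finset.sum_ite_mem]

theorem aux_union {n : ℕ} (h : Fin n → ℝ) (U V : Finset (Fin n)) (hd : Disjoint U V) :
    restrict h (U ∪ V) = restrict h U + restrict h V := by
  funext i
  have := fun hi : i ∈ U => Finset.disjoint_left.1 hd hi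
  by_cases h1 : i ∈ U <;> by_cases h2 : i ∈ V <;> simp_all [_root_.restrict]

noncomputable def auxB {m n : ℕ} (A : Matrix (Fin m) (Fin n) ℝ) (u v : Fin n → ℝ) : ℝ :=
  ∑ j, A.mulVec u j * A.mulVec v j

theorem auxB_add {m n : ℕ} (A : Matrix (Fin m) (Fin n) ℝ) (u v z : Fin n → ℝ) :
    auxB A u (v + z) = auxB A u v + auxB A u z := by
  simp [auxB, Matrix.mulVec_add, mul_add, Finset.sum_add_distrib]

theorem auxB_comm {m n : ℕ} (A : Matrix (Fin m) (Fin n) ℝ) (u v : Fin n → ℝ) :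
    auxB A u v = auxB A v u := by
  simp [auxB, mul_comm]

theorem aux_RO {m n : ℕ} (A : Matrix (Fin m) (Fin n) ℝ) (t : ℕ) (θ : ℝ)
    (hRO : ROineq A t t θ) (h : Fin n → ℝ) (U V : Finset (Fin n)) (hd : Disjoint U V)
    (hU : U.card ≤ t) (hV : V.card ≤ t) :
    |auxB A (restrict h U) (restrict h V)| ≤
      θ * Real.sqrt (∑ i ∈ U, h i ^ 2) * Real.sqrt (∑ i ∈ V, h i ^ 2) := by
  have := hRO (restrict h U) (restrict h V) (by
    intro i
    by_cases h1 : i ∈ U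
    · right
      simp [_root_.restrict, Finset.disjoint_left.1 hd h1]
    · left
      simp [_root_.restrict, h1]) ((aux_norm0 h U).trans hU) ((aux_norm0 h V).trans hV)
  rwa [aux_sq, aux_sq] at this

theorem aux_block {n : ℕ} (t : ℕ) (ht : 0 < t) (h : Fin n → ℝ) (V W : Finset (Fin n))
    (hV : V.card = t) (hW : W.card ≤ t) (hVW : ∀ i ∈ V, ∀ j ∈ W, |h j| ≤ |h i|) :
    Real.sqrt (∑ i ∈ W, h i ^ 2) ≤ (∑ i ∈ V, |h i|) / Real.sqrt t := by
  have ht' : (0 : ℝ) < t := by exact_mod_cast ht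
  have hs : 0 ≤ ∑ i ∈ V, |h i| := Finset.sum_nonneg fun _ _ => abs_nonneg _
  apply Real.sqrt_le_iff.2
  refine ⟨by positivity, ?_⟩
  rw [div_pow, Real.sq_sqrt ht'.le]
  have hj : ∀ j ∈ W, h j ^ 2 ≤ ((∑ i ∈ V, |h i|) / t) ^ 2 := by
    intro j hj
    rw [← sq_abs (h j)]
    apply pow_le_pow_left₀ (abs_nonneg _)
    rw [le_div_iff₀ ht']
    have := Finset.card_nsmul_le_sum V (fun i => |h i|) |h j| (fun i hi => hVW i hi j hj)
    rw [hV, nsmul_eq_mul] at this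
    linarith
  calc ∑ i ∈ W, h i ^ 2 ≤ W.card • ((∑ i ∈ V, |h i|) / t) ^ 2 := Finset.sum_le_card_nsmul _ _ _ hj
    _ ≤ t * ((∑ i ∈ V, |h i|) / t) ^ 2 := by
        rw [nsmul_eq_mul]
        have : (W.card : ℝ) ≤ t := by exact_mod_cast hW
        gcongr
    _ = _ := by field_simp

theorem aux_decomp {m n : ℕ} (A : Matrix (Fin m) (Fin n) ℝ) (t : ℕ) (ht : 0 < t) (θ : ℝ)
    (hθ : 0 ≤ θ) (hRO : ROineq A t t θ) (h : Fin n → ℝ) (N : ℕ) :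
    ∀ U : Finset (Fin n), U.card ≤ N →
    ∃ V ⊆ U, V.card ≤ t ∧ ∀ W : Finset (Fin n), W.card ≤ t → Disjoint W (U \ V) →
      |auxB A (restrict h W) (restrict h (U \ V))| ≤
        θ * Real.sqrt (∑ i ∈ W, h i ^ 2) * ((∑ i ∈ U, |h i|) / Real.sqrt t) := by
  induction N with
  | zero =>
    intro U hU
    refine ⟨U, subset_rfl, by omega, fun W hW hd => ?_⟩
    have hz : restrict h (U \ U) = 0 := by funext i; simp [_root_.restrict]
    have hs : 0 ≤ ∑ i ∈ U, |h i| := Finset.sum_nonneg fun _ _ => abs_nonneg _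
    rw [hz]
    simp only [auxB, Matrix.mulVec_zero, Pi.zero_apply, mul_zero, Finset.sum_const_zero, abs_zero]
    positivity
  | succ N ih =>
    intro U hU
    by_cases hUt : U.card ≤ t
    · refine ⟨U, subset_rfl, hUt, fun W hW hd => ?_⟩
      have hz : restrict h (U \ U) = 0 := by funext i; simp [_root_.restrict]
      have hs : 0 ≤ ∑ i ∈ U, |h i| := Finset.sum_nonneg fun _ _ => abs_nonneg _
      rw [hz]
      simp only [auxB, Matrix.mulVec_zero, Pi.zero_apply, mul_zero, Finset.sum_const_zero, abs_zero]
      positivity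
    · obtain ⟨V, hVU, hVc, hV⟩ := aux_top (fun i => |h i|) U t (by omega)
      obtain ⟨V2, hV2U, hV2c, hV2⟩ := ih (U \ V) (by
        rw [Finset.card_sdiff_of_subset hVU]; omega)
      refine ⟨V, hVU, hVc.le, fun W hW hd => ?_⟩
      have hsplit : U \ V = V2 ∪ ((U \ V) \ V2) := (Finset.union_sdiff_of_subset hV2U).symm
      have hr : restrict h (U \ V) = restrict h V2 + restrict h ((U \ V) \ V2) := by
        rw [← aux_union _ _ _ Finset.disjoint_sdiff, ← hsplit]
      rw [hr, auxB_add]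
      have e1 := aux_RO A t θ hRO h W V2 (hd.mono_right hV2U) hW hV2c
      have e2 := hV2 W hW (hd.mono_right Finset.sdiff_subset)
      have e3 := aux_block t ht h V V2 hVc hV2c (fun i hi j hj => hV i hi j (hV2U hj))
      have e4 : ∑ i ∈ U, |h i| = ∑ i ∈ V, |h i| + ∑ i ∈ U \ V, |h i| := by
        rw [add_comm, Finset.sum_sdiff hVU]
      have e5 : θ * Real.sqrt (∑ i ∈ W, h i ^ 2) * Real.sqrt (∑ i ∈ V2, h i ^ 2) ≤
          θ * Real.sqrt (∑ i ∈ W, h i ^ 2) * ((∑ i ∈ V, |h i|) / Real.sqrt t) := by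
        gcongr
      rw [e4, add_div, mul_add]
      exact (abs_add_le _ _).trans (by linarith)

theorem aux_core {m n : ℕ} (A : Matrix (Fin m) (Fin n) ℝ) (t : ℕ) (ht : 0 < t) (δ θ : ℝ)
    (hθ : 0 ≤ θ) (hRIP : RIPineq A t δ) (hRO : ROineq A t t θ) (hlt : δ + θ < 1)
    (S : Finset (Fin n)) (hS : S.card ≤ t) (h : Fin n → ℝ) (hA : A.mulVec h = 0) :
    (1 - δ - θ) * Real.sqrt (∑ i ∈ S, h i ^ 2) ≤
      θ * ((∑ i ∈ Sᶜ, |h i|) / Real.sqrt t) := by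
  obtain ⟨V, hVU, hVc, hV⟩ := aux_decomp A t ht θ hθ hRO h _ Sᶜ le_rfl
  have hSc : Disjoint S Sᶜ := disjoint_compl_right
  have hSV : Disjoint S V := hSc.mono_right hVU
  have h1 : restrict h (Sᶜ) = restrict h V + restrict h (Sᶜ \ V) := by
    rw [← aux_union _ _ _ Finset.disjoint_sdiff, Finset.union_sdiff_of_subset hVU]
  have h2 : h = restrict h S + (restrict h V + restrict h (Sᶜ \ V)) := by
    rw [← h1, ← aux_union _ _ _ hSc, Finset.union_compl]
    funext i; simp [_root_.restrict]
  have hz : ∀ v, auxB A v h = 0 := by intro v; simp [auxB, hA]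
  have key : ∀ W : Finset (Fin n), W.card ≤ t →
      (1 - δ) * Real.sqrt (∑ i ∈ W, h i ^ 2) ^ 2 ≤ auxB A (restrict h W) (restrict h W) := by
    intro W hW
    have := (hRIP (restrict h W) ((aux_norm0 h W).trans hW)).1
    rw [aux_sq] at this
    rw [Real.sq_sqrt (Finset.sum_nonneg fun _ _ => sq_nonneg _)]
    simpa [auxB, sq] using this
  have kS := key S hS
  have kV := key V hVc
  have zS := hz (restrict h S)
  have zV := hz (restrict h V)
  rw [h2, auxB_add, auxB_add] at zS zV
  rw [← h2] at zS zV
  have bSV := aux_RO A t θ hRO h S V hSV hS hVc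
  have bSR := hV S hS (hSc.mono_right Finset.sdiff_subset)
  have bVR := hV V hVc Finset.disjoint_sdiff
  rw [auxB_comm A (restrict h V) (restrict h S)] at zV
  have ha := Real.sqrt_nonneg (∑ i ∈ S, h i ^ 2)
  have hb := Real.sqrt_nonneg (∑ i ∈ V, h i ^ 2)
  have hL : 0 ≤ (∑ i ∈ Sᶜ, |h i|) / Real.sqrt t :=
    div_nonneg (Finset.sum_nonneg fun _ _ => abs_nonneg _) (Real.sqrt_nonneg _)
  generalize Real.sqrt (∑ i ∈ S, h i ^ 2) = a at *
  generalize Real.sqrt (∑ i ∈ V, h i ^ 2) = b at *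
  generalize (∑ i ∈ Sᶜ, |h i|) / Real.sqrt t = L at *
  have cS : (1 - δ) * a ^ 2 ≤ θ * a * b + θ * a * L := by
    linarith [(abs_le.1 bSV).1, (abs_le.1 bSR).1]
  have cV : (1 - δ) * b ^ 2 ≤ θ * a * b + θ * b * L := by
    linarith [(abs_le.1 bSV).1, (abs_le.1 bVR).1]
  have gen : ∀ p q : ℝ, 0 ≤ p → q ≤ p → (1 - δ) * p ^ 2 ≤ θ * p * q + θ * p * L →
      (1 - δ - θ) * p ≤ θ * L := by
    intro p q hp hq hpq
    rcases hp.eq_or_lt with rfl | hp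
    · simpa using mul_nonneg hθ hL
    · have : θ * p * q ≤ θ * p * p := by gcongr
      refine le_of_mul_le_mul_left ?_ hp
      linarith
  rcases le_total b a with hab | hab
  · exact gen a b ha hab cS
  · have := gen b a hb hab (by linarith)
    have h3 : (1 - δ - θ) * a ≤ (1 - δ - θ) * b :=
      mul_le_mul_of_nonneg_left hab (by linarith)
    linarith

theorem aux_dual {m n : ℕ} (A : Matrix (Fin m) (Fin n) ℝ) (S : Finset (Fin n)) (c : Fin n → ℝ)
    (hcS : ∀ i, i ∉ S → c i = 0) (ρ : ℝ) (hρ : 0 ≤ ρ)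
    (hk : ∀ h : Fin n → ℝ, A.mulVec h = 0 → ∑ i, c i * h i ≤ ρ * ∑ i ∈ Sᶜ, |h i|) :
    ∃ γ : Fin m → ℝ, (∀ i ∈ S, ∑ j, γ j * A j i = c i) ∧
      ∀ i, i ∉ S → |∑ j, γ j * A j i| ≤ ρ := by
  let C : (Fin n → ℝ) →ₗ[ℝ] ℝ := ∑ i, c i • LinearMap.proj i
  have hC : ∀ h, C h = ∑ i, c i * h i := by intro h; simp [C]
  let K := LinearMap.ker A.mulVecLin
  obtain ⟨g, hg1, hg2⟩ := exists_extension_of_le_sublinear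
    (⟨K, C.comp K.subtype⟩ : (Fin n → ℝ) →ₗ.[ℝ] ℝ) (fun h => ρ * ∑ i ∈ Sᶜ, |h i|)
    (by
      intro r hr x
      simp only [Pi.smul_apply, smul_eq_mul, abs_mul, abs_of_pos hr, ← Finset.mul_sum]
      ring)
    (by
      intro x y
      rw [← mul_add, ← Finset.sum_add_distrib]
      exact mul_le_mul_of_nonneg_left (Finset.sum_le_sum fun i _ => abs_add_le _ _) hρ)
    (by
      intro x
      have := hk x.1 (LinearMap.mem_ker.1 x.2)
      rw [← hC] at this
      exact this)
  have hmem : C - g ∈ (LinearMap.ker A.mulVecLin).dualAnnihilator := by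
    rw [Submodule.mem_dualAnnihilator]
    intro h hh
    have := hg1 ⟨h, hh⟩
    have h2 : g h = C h := this
    simp [h2]
  rw [← LinearMap.range_dualMap_eq_dualAnnihilator_ker] at hmem
  obtain ⟨φ, hφ⟩ := hmem
  have hφi : ∀ i, ∑ j, φ (Pi.single j 1) * A j i = c i - g (Pi.single i 1) := by
    intro i
    have h1 : φ (A.mulVecLin (Pi.single i 1)) = C (Pi.single i 1) - g (Pi.single i 1) := by
      have := congrArg (fun F => F (Pi.single i (1 : ℝ))) hφ
      simpa using this
    have h2 : C (Pi.single i 1) = c i := by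
      rw [hC]; simp [Pi.single_apply]
    rw [h2] at h1
    rw [← h1, LinearMap.pi_apply_eq_sum_univ φ]
    refine Finset.sum_congr rfl fun j _ => ?_
    have h3 : (fun j' => if j = j' then (1 : ℝ) else 0) = Pi.single j 1 := by
      funext j'; simp [Pi.single_apply, eq_comm]
    rw [h3]
    simp [mul_comm]
  have hgS : ∀ i, |g (Pi.single i 1)| ≤ ρ * ∑ j ∈ Sᶜ, |(Pi.single i 1 : Fin n → ℝ) j| := by
    intro i
    rw [abs_le]
    constructor
    · have := hg2 (-Pi.single i 1)
      simp only [map_neg, Pi.neg_apply, abs_neg] at this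
      linarith
    · exact hg2 _
  refine ⟨fun j => φ (Pi.single j 1), fun i hi => ?_, fun i hi => ?_⟩
  · have h1 := hgS i
    have h2 : ∑ j ∈ Sᶜ, |(Pi.single i 1 : Fin n → ℝ) j| = 0 := by
      apply Finset.sum_eq_zero
      intro j hj
      have : j ≠ i := by rintro rfl; exact (Finset.mem_compl.1 hj) hi
      simp [this]
    rw [h2, mul_zero] at h1
    have h3 := abs_nonpos_iff.1 h1
    rw [hφi, h3, sub_zero]
  · have h1 := hgS i
    have h2 : ∑ j ∈ Sᶜ, |(Pi.single i 1 : Fin n → ℝ) j| = 1 := by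
      rw [Finset.sum_eq_single i]
      · simp
      · intro j _ hj
        simp [hj]
      · intro h; exact absurd (Finset.mem_compl.2 hi) h
    rw [h2, mul_one] at h1
    rw [hφi, hcS i hi, zero_sub, abs_neg]
    exact h1

theorem stmt_8 {m n : ℕ} (A : Matrix (Fin m) (Fin n) ℝ) (hmn : m < n)
    (x : Fin n → ℝ) (N T Δ : Finset (Fin n)) (s k u : ℕ)
    (hsupp : ∀ i, i ∉ N → x i = 0) (hNs : N.card = s)
    (hTk : T.card = k) (hΔdef : Δ = Tᶜ ∩ N) (hΔu : Δ.card = u)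
    (w : ℝ) (hw0 : 0 ≤ w) (hw1 : w ≤ 1)
    (c : Fin n → ℝ)
    (hc : ∀ i, c i = if i ∈ T then w * Real.sign (x i)
      else if i ∈ Δ then Real.sign (x i) else 0)
    (δ θ₁ θ₂ : ℝ) (hδ0 : 0 ≤ δ) (hθ₁0 : 0 ≤ θ₁) (hθ₂0 : 0 ≤ θ₂)
    (hRIP : RIPineq A (k + u) δ)
    (hRO1 : ROineq A (k + u) (k + u) θ₁)
    (hRO2 : ROineq A (k + u) (2 * (k + u)) θ₂)
    (hcond : Real.sqrt (((k : ℝ) * w ^ 2 + u) / ((k : ℝ) + u)) * θ₁ + δ + θ₂ < 1) :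
    ∃ γ : Fin m → ℝ,
      (∀ i ∈ T, (∑ j, γ j * A j i) = w * Real.sign (x i)) ∧
      (∀ i ∈ Δ, (∑ j, γ j * A j i) = Real.sign (x i)) ∧
      (∀ i, i ∉ T ∪ Δ → |∑ j, γ j * A j i| < 1) := by
  have hTΔ : Disjoint T Δ := by
    rw [hΔdef, Finset.disjoint_left]
    intro i hi
    simp [hi]
  have hcard : (T ∪ Δ).card = k + u := by
    rw [Finset.card_union_of_disjoint hTΔ, hTk, hΔu]
  rcases Nat.eq_zero_or_pos (k + u) with h0 | ht
  · rw [h0] at hcard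
    have hE := Finset.card_eq_zero.1 hcard
    refine ⟨0, ?_, ?_, ?_⟩
    · intro i hi
      have : i ∈ T ∪ Δ := Finset.mem_union_left _ hi
      simp [hE] at this
    · intro i hi
      have : i ∈ T ∪ Δ := Finset.mem_union_right _ hi
      simp [hE] at this
    · intro i _
      simp
  have ht' : (0 : ℝ) < (k : ℝ) + u := by exact_mod_cast ht
  set r := Real.sqrt (((k : ℝ) * w ^ 2 + u) / ((k : ℝ) + u)) with hr
  have hr0 : 0 ≤ r := Real.sqrt_nonneg _
  have hRO2' : ROineq A (k + u) (k + u) θ₂ := fun a b hab ha hb =>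
    hRO2 a b hab ha (by omega)
  obtain ⟨θ, hθ0, hRO, hθ1, hθ2⟩ : ∃ θ : ℝ, 0 ≤ θ ∧ ROineq A (k + u) (k + u) θ ∧
      θ ≤ θ₁ ∧ θ ≤ θ₂ := by
    rcases le_total θ₁ θ₂ with h | h
    · exact ⟨θ₁, hθ₁0, hRO1, le_rfl, h⟩
    · exact ⟨θ₂, hθ₂0, hRO2', h, le_rfl⟩
  have hrθ : r * θ ≤ r * θ₁ := by gcongr
  have hrθ1 : 0 ≤ r * θ := by positivity
  have hD : 0 < 1 - δ - θ := by linarith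
  have hρ1 : r * θ / (1 - δ - θ) < 1 := by
    rw [div_lt_one hD]; linarith
  have hcS : ∀ i, i ∉ T ∪ Δ → c i = 0 := by
    intro i hi
    rw [Finset.mem_union, not_or] at hi
    rw [hc, if_neg hi.1, if_neg hi.2]
  have hsgn : ∀ y : ℝ, Real.sign y ^ 2 ≤ 1 := by
    intro y
    rcases Real.sign_apply_eq y with h | h | h <;> rw [h] <;> norm_num
  have hc2 : ∑ i ∈ T ∪ Δ, c i ^ 2 ≤ (k : ℝ) * w ^ 2 + u := by
    rw [Finset.sum_union hTΔ]
    have e1 : ∑ i ∈ T, c i ^ 2 ≤ T.card • w ^ 2 := by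
      apply Finset.sum_le_card_nsmul
      intro i hi
      rw [hc, if_pos hi, mul_pow]
      exact mul_le_of_le_one_right (sq_nonneg _) (hsgn _)
    have e2 : ∑ i ∈ Δ, c i ^ 2 ≤ Δ.card • (1 : ℝ) := by
      apply Finset.sum_le_card_nsmul
      intro i hi
      rw [hc, if_neg (Finset.disjoint_right.1 hTΔ hi), if_pos hi]
      exact hsgn _
    rw [hTk, nsmul_eq_mul] at e1
    rw [hΔu, nsmul_eq_mul, mul_one] at e2
    linarith
  obtain ⟨γ, hγ1, hγ2⟩ := aux_dual A (T ∪ Δ) c hcS (r * θ / (1 - δ - θ)) (by positivity) (by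
    intro h hA
    have core := aux_core A (k + u) ht δ θ hθ0 hRIP hRO (by linarith) (T ∪ Δ) hcard.le h hA
    have e1 : ∑ i, c i * h i = ∑ i ∈ T ∪ Δ, c i * h i := by
      symm
      apply Finset.sum_subset (Finset.subset_univ _)
      intro i _ hi
      rw [hcS i hi, zero_mul]
    have e2 := Real.sum_mul_le_sqrt_mul_sqrt (T ∪ Δ) c h
    have hst : 0 < Real.sqrt ((k : ℝ) + u) := Real.sqrt_pos.2 ht'
    have e3 : Real.sqrt (∑ i ∈ T ∪ Δ, c i ^ 2) ≤ r * Real.sqrt ((k : ℝ) + u) := by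
      rw [hr, ← Real.sqrt_mul (by positivity), div_mul_cancel₀ _ ht'.ne']
      exact Real.sqrt_le_sqrt hc2
    have e4 := mul_le_mul_of_nonneg_right e3 (Real.sqrt_nonneg (∑ i ∈ T ∪ Δ, h i ^ 2))
    rw [e1]
    refine (e2.trans e4).trans ?_
    push_cast at core
    generalize Real.sqrt (∑ i ∈ T ∪ Δ, h i ^ 2) = a at *
    generalize Real.sqrt ((k : ℝ) + u) = q at *
    generalize (∑ i ∈ (T ∪ Δ)ᶜ, |h i|) = L at *
    rw [div_mul_eq_mul_div, le_div_iff₀ hD]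
    have e5 := mul_le_mul_of_nonneg_left core (mul_nonneg hr0 hst.le)
    have e6 : r * q * (θ * (L / q)) = r * θ * L := by
      field_simp
    linarith)
  refine ⟨γ, ?_, ?_, ?_⟩
  · intro i hi
    rw [hγ1 i (Finset.mem_union_left _ hi), hc, if_pos hi]
  · intro i hi
    rw [hγ1 i (Finset.mem_union_right _ hi), hc, if_neg (Finset.disjoint_right.1 hTΔ hi), if_pos hi]
  · intro i hi
    exact (hγ2 i hi).trans_lt hρ1
end

section
/- Let A be an m×n real matrix with columns a₁,…,aₙ, let x ∈ ℝⁿ be supported on N ⊆ {1,…,n}, let T ⊆ {1,…,n} and Δ = T^c ∩ N, and let w ∈ [0,1]. Suppose there exists γ ∈ ℝᵐ with ⟨γ, aᵢ⟩ = w·sgn(xᵢ) for i ∈ T, ⟨γ, aᵢ⟩ = sgn(xᵢ) for i ∈ Δ, and |⟨γ, aᵢ⟩| < 1 for i ∈ (T ∪ Δ)^c. Suppose also that the columns of A indexed by T ∪ Δ are linearly independent. Then x is the unique minimizer of the weighted 1-norm ‖z‖₁,w := w·Σ_{i∈T}|zᵢ| + Σ_{i∉T}|zᵢ| subject to Az =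 Ax: every z ∈ ℝⁿ with Az = Ax and z ≠ x satisfies ‖z‖₁,w > ‖x‖₁,w. -/
open Classical Finset

theorem stmt_10 {m n : ℕ} (A : Matrix (Fin m) (Fin n) ℝ)
    (x : Fin n → ℝ) (N T Δ : Finset (Fin n))
    (hsupp : ∀ i, i ∉ N → x i = 0) (hΔdef : Δ = Tᶜ ∩ N)
    (w : ℝ) (hw0 : 0 ≤ w) (hw1 : w ≤ 1)
    (γ : Fin m → ℝ)
    (hγT : ∀ i ∈ T, (∑ j, γ j * A j i) = w * Real.sign (x i))
    (hγΔ : ∀ i ∈ Δ, (∑ j, γ j * A j i) = Real.sign (x i))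
    (hγc : ∀ i, i ∉ T ∪ Δ → |∑ j, γ j * A j i| < 1)
    (hli : LinearIndependent ℝ (fun i : ↥(T ∪ Δ) => fun j => A j i.1)) :
    ∀ z : Fin n → ℝ, A.mulVec z = A.mulVec x → z ≠ x →
      w * (∑ i ∈ T, |x i|) + (∑ i ∈ Tᶜ, |x i|) <
        w * (∑ i ∈ T, |z i|) + (∑ i ∈ Tᶜ, |z i|) := by
  intro z hz hne
  set g : Fin n → ℝ := fun i => ∑ j, γ j * A j i with hg
  have hdual : ∀ y : Fin n → ℝ, ∑ i, g i * y i = ∑ j, γ j * A.mulVec y j := by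
    intro y
    simp only [hg, Matrix.mulVec, dotProduct, Finset.sum_mul, Finset.mul_sum]
    rw [Finset.sum_comm]
    refine Finset.sum_congr rfl fun j _ => Finset.sum_congr rfl fun i _ => by ring
  have hsum : ∑ i, g i * z i = ∑ i, g i * x i := by rw [hdual, hdual, hz]
  have hx0 : ∀ i, i ∉ T ∪ Δ → x i = 0 := by
    intro i hi
    apply hsupp
    intro hN
    apply hi
    subst hΔdef
    by_cases hT : i ∈ T <;> simp [hT, hN]
  obtain ⟨k, hk, hzk⟩ : ∃ k, k ∉ T ∪ Δ ∧ z k ≠ 0 := by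
    by_contra hcon
    push Not at hcon
    apply hne
    have hout : ∀ i, i ∉ T ∪ Δ → z i - x i = 0 := fun i hi => by
      rw [hcon i hi, hx0 i hi, sub_zero]
    have hlin := Fintype.linearIndependent_iff.1 hli (fun i => z i.1 - x i.1) (by
      funext j
      have h1 : ∑ i, A j i * (z i - x i) = 0 := by
        have h2 := congrFun hz j
        simp only [Matrix.mulVec, dotProduct] at h2
        simp only [mul_sub, Finset.sum_sub_distrib, h2, sub_self]
      have h3 : ∑ i ∈ T ∪ Δ, A j i * (z i - x i) = ∑ i, A j i * (z i - x i) :=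
        Finset.sum_subset (Finset.subset_univ _) fun i _ hi => by rw [hout i hi, mul_zero]
      rw [h1, ← Finset.sum_coe_sort] at h3
      simp only [Finset.sum_apply, Pi.smul_apply, smul_eq_mul, Pi.zero_apply]
      rw [← h3]
      exact Finset.sum_congr rfl fun i _ => mul_comm _ _)
    funext i
    by_cases hi : i ∈ T ∪ Δ
    · exact sub_eq_zero.1 (hlin ⟨i, hi⟩)
    · exact sub_eq_zero.1 (hout i hi)
  have hconv : ∀ y : Fin n → ℝ, w * (∑ i ∈ T, |y i|) + (∑ i ∈ Tᶜ, |y i|)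
      = ∑ i, (if i ∈ T then w else 1) * |y i| := by
    intro y
    rw [← Finset.sum_add_sum_compl T, Finset.mul_sum]
    congr 1
    · exact Finset.sum_congr rfl fun i hi => by rw [if_pos hi]
    · exact Finset.sum_congr rfl fun i hi => by rw [if_neg (Finset.mem_compl.1 hi), one_mul]
  have hsx : ∀ r : ℝ, Real.sign r * r = |r| := by
    intro r
    rcases lt_trichotomy r 0 with h | h | h
    · rw [Real.sign_of_neg h, abs_of_neg h]; ring
    · simp [h]
    · rw [Real.sign_of_pos h, abs_of_pos h]; ring
  have hsz : ∀ r s : ℝ, Real.sign r * s ≤ |s| := by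
    intro r s
    rcases lt_trichotomy r 0 with h | h | h
    · rw [Real.sign_of_neg h]; linarith [neg_abs_le s]
    · simp [h]
    · rw [Real.sign_of_pos h]; linarith [le_abs_self s]
  have hstrict : ∀ i, i ∉ T ∪ Δ → z i ≠ 0 → g i * z i < |z i| := by
    intro i hi hzi
    have h1 : |g i| < 1 := hγc i hi
    have h2 : 0 < |z i| := abs_pos.2 hzi
    calc g i * z i ≤ |g i| * |z i| := by rw [← abs_mul]; exact le_abs_self _
      _ < 1 * |z i| := by gcongr
      _ = |z i| := one_mul _
  have hxeq : ∑ i, (if i ∈ T then w else 1) * |x i| = ∑ i, g i * x i := by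
    refine Finset.sum_congr rfl fun i _ => ?_
    by_cases hT : i ∈ T
    · rw [if_pos hT, show g i = _ from hγT i hT, mul_assoc, hsx]
    · rw [if_neg hT, one_mul]
      by_cases hD : i ∈ Δ
      · rw [show g i = _ from hγΔ i hD, hsx]
      · rw [hx0 i (by simp [hT, hD])]; simp
  rw [hconv, hconv, hxeq, ← hsum]
  refine Finset.sum_lt_sum (fun i _ => ?_) ⟨k, Finset.mem_univ _, ?_⟩
  · by_cases hT : i ∈ T
    · rw [if_pos hT, show g i = _ from hγT i hT, mul_assoc]
      exact mul_le_mul_of_nonneg_left (hsz _ _) hw0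
    · rw [if_neg hT, one_mul]
      by_cases hD : i ∈ Δ
      · rw [show g i = _ from hγΔ i hD]
        exact hsz _ _
      · by_cases hzi : z i = 0
        · simp [hzi]
        · exact (hstrict i (by simp [hT, hD]) hzi).le
  · rw [if_neg (fun h => hk (Finset.mem_union_left _ h)), one_mul]
    exact hstrict k hk hzk
end

section
/- Let A be an m×n real matrix and let s, s̃ ≥ 1 with s + s̃ ≤ n. If δ ≥ 0 satisfies the (s+s̃)-restricted isometry inequality for A, then δ satisfies the (s,s̃)-restricted orthogonality inequality for A; that is, for all u, v ∈ ℝⁿ with disjoint supports, u having at most s and v at most s̃ nonzero entries, |⟨Au, Av⟩| ≤ δ·‖u‖₂·‖v‖₂. -/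
open Classical Finset

lemma norm0_comb {n s s' : ℕ} (u v : Fin n → ℝ) (hu : norm0 u ≤ s) (hv : norm0 v ≤ s')
    (a b : ℝ) : norm0 (a • u + b • v) ≤ s + s' := by
  refine le_trans ?_ (Nat.add_le_add hu hv)
  unfold norm0
  refine le_trans (Finset.card_le_card ?_) (Finset.card_union_le _ _)
  intro i hi
  simp only [Finset.mem_filter, Finset.mem_union, Finset.mem_univ, true_and] at hi ⊢
  by_contra h
  push Not at h
  apply hi
  simp [h.1, h.2]

lemma sum_sq_comb {ι : Type*} [Fintype ι] (x y : ι → ℝ) (a b : ℝ) :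
    ∑ i, (a * x i + b * y i) ^ 2 =
      a ^ 2 * ∑ i, x i ^ 2 + 2 * (a * b) * ∑ i, x i * y i + b ^ 2 * ∑ i, y i ^ 2 := by
  simp only [Finset.mul_sum, ← Finset.sum_add_distrib]
  exact Finset.sum_congr rfl fun i _ => by ring

theorem stmt_11 {m n : ℕ} (A : Matrix (Fin m) (Fin n) ℝ)
    (s s' : ℕ) (hs : 1 ≤ s) (hs' : 1 ≤ s') (hss' : s + s' ≤ n)
    (δ : ℝ) (hδ0 : 0 ≤ δ) (hRIP : RIPineq A (s + s') δ) :
    ROineq A s s' δ := by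
  intro u v hd hu hv
  have key : ∀ a b : ℝ,
      (1 - δ) * (a ^ 2 * ∑ i, u i ^ 2 + b ^ 2 * ∑ i, v i ^ 2) ≤
        a ^ 2 * ∑ j, A.mulVec u j ^ 2 + 2 * (a * b) * ∑ j, A.mulVec u j * A.mulVec v j
          + b ^ 2 * ∑ j, A.mulVec v j ^ 2 ∧
      a ^ 2 * ∑ j, A.mulVec u j ^ 2 + 2 * (a * b) * ∑ j, A.mulVec u j * A.mulVec v j
          + b ^ 2 * ∑ j, A.mulVec v j ^ 2 ≤
        (1 + δ) * (a ^ 2 * ∑ i, u i ^ 2 + b ^ 2 * ∑ i, v i ^ 2) := by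
    intro a b
    have h := hRIP (a • u + b • v) (norm0_comb u v hu hv a b)
    have h0 : ∑ i, u i * v i = 0 := Finset.sum_eq_zero fun i _ => by
      rcases hd i with h | h <;> simp [h]
    simp only [Matrix.mulVec_add, Matrix.mulVec_smul, Pi.add_apply, Pi.smul_apply, smul_eq_mul,
      sum_sq_comb, h0, mul_zero, add_zero] at h
    exact h
  have zero : ∀ w : Fin n → ℝ, ∑ i, w i ^ 2 = 0 → w = 0 := by
    intro w hw
    rw [Finset.sum_eq_zero_iff_of_nonneg (fun i _ => sq_nonneg _)] at hw
    funext i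
    simpa using hw i (Finset.mem_univ i)
  have hP : 0 ≤ ∑ i, u i ^ 2 := Finset.sum_nonneg fun i _ => sq_nonneg _
  have hQ : 0 ≤ ∑ i, v i ^ 2 := Finset.sum_nonneg fun i _ => sq_nonneg _
  rcases hP.eq_or_lt with hP0 | hP0
  · simp [zero u hP0.symm]
  rcases hQ.eq_or_lt with hQ0 | hQ0
  · simp [zero v hQ0.symm]
  have hp := Real.sqrt_pos.2 hP0
  have hq := Real.sqrt_pos.2 hQ0
  have hp2 := Real.sq_sqrt hP
  have hq2 := Real.sq_sqrt hQ
  generalize Real.sqrt (∑ i, u i ^ 2) = p at *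
  generalize Real.sqrt (∑ i, v i ^ 2) = q at *
  rw [← hp2, ← hq2] at key
  have k1 := key q p
  have k2 := key q (-p)
  have hpq := mul_pos hp hq
  rw [abs_le]
  constructor
  · refine le_of_mul_le_mul_left ?_ hpq
    linarith [k1.1, k2.2]
  · refine le_of_mul_le_mul_left ?_ hpq
    linarith [k1.2, k2.1]
end

section
/- Let A be an m×n real matrix with m < n, let x ∈ ℝⁿ be supported on N ⊆ {1,…,n}, and put y := Ax. Let T ⊆ {1,…,n} with |T| = k and Δ = T^c ∩ N with |Δ| = u, and suppose u ≤ k. If some δ < √2/(1 + 2√2) (≈ 0.369) satisfies the 3(k+u)-restricted isometry inequality for A, then x is the unique minimizer of ‖z_{T^c}‖₁ subject to Az = y: every z ∈ ℝⁿ with Az = y and z ≠ x satisfies ‖z_{T^c}‖₁ > ‖x_{T^c}‖₁. -/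
open Classical Finset

lemma norm0_le_of_supp {n : ℕ} (z : Fin n → ℝ) (V : Finset (Fin n))
    (hV : ∀ i, i ∉ V → z i = 0) : norm0 z ≤ V.card := by
  unfold norm0
  apply Finset.card_le_card
  intro i hi
  by_contra h
  exact (Finset.mem_filter.mp hi).2 (hV i h)

lemma exists_top_s12 {n : ℕ} (h : Fin n → ℝ) (R : Finset (Fin n)) (s : ℕ) :
    ∃ B ⊆ R, B.card ≤ s ∧ (B = R ∨ B.card = s) ∧ ∀ i ∈ R \ B, ∀ j ∈ B, |h i| ≤ |h j| := by
  induction s with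
  | zero => exact ⟨∅, by simp, by simp, by simp, by simp⟩
  | succ s ih =>
    obtain ⟨B, hBR, hc, hor, hle⟩ := ih
    by_cases hB : B = R
    · exact ⟨B, hBR, by omega, Or.inl hB, hle⟩
    · have hcs : B.card = s := by tauto
      have hne : (R \ B).Nonempty := by
        rw [Finset.sdiff_nonempty]
        intro hRB
        exact hB (Finset.Subset.antisymm hBR hRB)
      obtain ⟨a, ha, hmax⟩ := Finset.exists_max_image (R \ B) (fun i => |h i|) hne
      have ha2 := Finset.mem_sdiff.mp ha
      have hci : (insert a B).card = s + 1 := by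
        rw [Finset.card_insert_of_notMem ha2.2, hcs]
      refine ⟨insert a B, Finset.insert_subset ha2.1 hBR, hci.le, Or.inr hci, ?_⟩
      intro i hi j hj
      have hi' : i ∈ R \ B := by
        simp only [Finset.mem_sdiff, Finset.mem_insert] at hi ⊢
        tauto
      rcases Finset.mem_insert.mp hj with rfl | hj
      · exact hmax i hi'
      · exact hle i hi' j hj

lemma exists_block {n : ℕ} (h : Fin n → ℝ) (R : Finset (Fin n)) (s : ℕ) :
    ∃ B ⊆ R, B.card ≤ s ∧ (B = R ∨ B.card = s) ∧ ∃ M : ℝ, 0 ≤ M ∧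
      (∀ i ∈ R \ B, |h i| ≤ M) ∧ (s : ℝ) * M ≤ ∑ i ∈ B, |h i| := by
  obtain ⟨B, hBR, hc, hor, hle⟩ := exists_top_s12 h R s
  refine ⟨B, hBR, hc, hor, ?_⟩
  by_cases hB : B = R
  · refine ⟨0, le_rfl, ?_, ?_⟩
    · intro i hi
      simp [hB] at hi
    · simp only [mul_zero]
      exact Finset.sum_nonneg fun i _ => abs_nonneg _
  · have hcs : B.card = s := by tauto
    have hne : (R \ B).Nonempty := by
      rw [Finset.sdiff_nonempty]
      intro hRB
      exact hB (Finset.Subset.antisymm hBR hRB)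
    obtain ⟨a, ha, hmax⟩ := Finset.exists_max_image (R \ B) (fun i => |h i|) hne
    refine ⟨|h a|, abs_nonneg _, hmax, ?_⟩
    have := Finset.card_nsmul_le_sum B (fun i => |h i|) (|h a|) (fun j hj => hle a ha j hj)
    rw [hcs, nsmul_eq_mul] at this
    exact this

lemma ro_bound {m n : ℕ} (A : Matrix (Fin m) (Fin n) ℝ) (K : ℕ) (δ : ℝ)
    (hR : RIPineq A K δ) (v w : Fin n → ℝ) (V W : Finset (Fin n))
    (hv : ∀ i, i ∉ V → v i = 0) (hw : ∀ i, i ∉ W → w i = 0) (hd : Disjoint V W)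
    (hc : V.card + W.card ≤ K) :
    -(∑ j, A.mulVec v j * A.mulVec w j) ≤
      δ * Real.sqrt (∑ i, v i ^ 2) * Real.sqrt (∑ i, w i ^ 2) := by
  have hvw : ∀ i, v i * w i = 0 := by
    intro i
    by_cases hi : i ∈ V
    · rw [hw i (Finset.disjoint_left.mp hd hi), mul_zero]
    · rw [hv i hi, zero_mul]
  have key : ∀ a b : ℝ, -(4 * a * b * ∑ j, A.mulVec v j * A.mulVec w j) ≤
      2 * δ * (a ^ 2 * (∑ i, v i ^ 2) + b ^ 2 * ∑ i, w i ^ 2) := by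
    intro a b
    have hn : ∀ c : ℝ, norm0 (a • v + c • w) ≤ K := by
      intro c
      refine (norm0_le_of_supp _ (V ∪ W) ?_).trans ((Finset.card_union_le _ _).trans hc)
      intro i hi
      simp only [Finset.mem_union, not_or] at hi
      simp [hv i hi.1, hw i hi.2]
    have hs : ∀ c : ℝ, ∑ i, (a • v + c • w) i ^ 2 =
        a ^ 2 * (∑ i, v i ^ 2) + c ^ 2 * ∑ i, w i ^ 2 := by
      intro c
      rw [Finset.mul_sum, Finset.mul_sum, ← Finset.sum_add_distrib]
      refine Finset.sum_congr rfl fun i _ => ?_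
      simp only [Pi.add_apply, Pi.smul_apply, smul_eq_mul]
      linear_combination 2 * a * c * hvw i
    have hA : ∀ c : ℝ, ∑ j, (A.mulVec (a • v + c • w) j) ^ 2 =
        a ^ 2 * (∑ j, A.mulVec v j ^ 2) + c ^ 2 * (∑ j, A.mulVec w j ^ 2)
          + 2 * a * c * ∑ j, A.mulVec v j * A.mulVec w j := by
      intro c
      rw [Finset.mul_sum, Finset.mul_sum, Finset.mul_sum, ← Finset.sum_add_distrib,
        ← Finset.sum_add_distrib]
      refine Finset.sum_congr rfl fun i _ => ?_
      rw [Matrix.mulVec_add, Matrix.mulVec_smul, Matrix.mulVec_smul]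
      simp only [Pi.add_apply, Pi.smul_apply, smul_eq_mul]
      ring
    have h1 := (hR _ (hn b)).1
    have h2 := (hR _ (hn (-b))).2
    rw [hs, hA] at h1 h2
    linarith
  have hp : 0 ≤ ∑ i, v i ^ 2 := Finset.sum_nonneg fun i _ => sq_nonneg _
  have hq : 0 ≤ ∑ i, w i ^ 2 := Finset.sum_nonneg fun i _ => sq_nonneg _
  have hz : ∀ t : Fin n → ℝ, ∑ i, t i ^ 2 = 0 → t = 0 := by
    intro t ht
    funext i
    have := (Finset.sum_eq_zero_iff_of_nonneg (fun i _ => sq_nonneg (t i))).mp ht i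
      (Finset.mem_univ i)
    simpa using this
  rcases hp.eq_or_lt with hp0 | hp0
  · rw [hz v hp0.symm]; simp
  rcases hq.eq_or_lt with hq0 | hq0
  · rw [hz w hq0.symm]; simp
  have hk := key (Real.sqrt (∑ i, w i ^ 2)) (Real.sqrt (∑ i, v i ^ 2))
  have hP := Real.sqrt_pos.mpr hp0
  have hQ := Real.sqrt_pos.mpr hq0
  have hP2 := Real.sq_sqrt hp
  have hQ2 := Real.sq_sqrt hq
  set P := Real.sqrt (∑ i, v i ^ 2)
  set Q := Real.sqrt (∑ i, w i ^ 2)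
  rw [← hP2, ← hQ2] at hk
  have hPQ : 0 < P * Q := mul_pos hP hQ
  refine le_of_mul_le_mul_left ?_ hPQ
  nlinarith

lemma restrict_split {n : ℕ} (h : Fin n → ℝ) (R B : Finset (Fin n)) (hB : B ⊆ R) :
    restrict h R = restrict h B + restrict h (R \ B) := by
  funext i
  simp only [_root_.restrict, Pi.add_apply, Finset.mem_sdiff]
  by_cases h1 : i ∈ B
  · simp [h1, hB h1]
  · simp [h1]

lemma restrict_sq {n : ℕ} (h : Fin n → ℝ) (R : Finset (Fin n)) :
    ∑ i, restrict h R i ^ 2 = ∑ i ∈ R, h i ^ 2 := by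
  simp [_root_.restrict, ite_pow, Finset.sum_ite_mem]

lemma tail_bound {m n : ℕ} (A : Matrix (Fin m) (Fin n) ℝ) (K s : ℕ) (δ : ℝ) (hδ : 0 ≤ δ)
    (hs : 0 < s) (hR : RIPineq A K δ) (v h : Fin n → ℝ) (V : Finset (Fin n))
    (hv : ∀ i, i ∉ V → v i = 0) (hc : V.card + s ≤ K) :
    ∀ (r : ℕ) (R : Finset (Fin n)), R.card ≤ r → Disjoint V R → ∀ M : ℝ, 0 ≤ M →
      (∀ i ∈ R, |h i| ≤ M) →
      -(∑ j, A.mulVec v j * A.mulVec (restrict h R) j) ≤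
        δ * Real.sqrt (∑ i, v i ^ 2) *
          (Real.sqrt s * M + (∑ i ∈ R, |h i|) / Real.sqrt s) := by
  have hs0 : (0 : ℝ) < s := by exact_mod_cast hs
  have hsq := Real.sqrt_pos.mpr hs0
  have hs2 := Real.sq_sqrt hs0.le
  have hδP : 0 ≤ δ * Real.sqrt (∑ i, v i ^ 2) := mul_nonneg hδ (Real.sqrt_nonneg _)
  intro r
  induction r with
  | zero =>
    intro R hr _ M hM _
    have : R = ∅ := Finset.card_eq_zero.mp (by omega)
    subst this
    have h0 : restrict h ∅ = 0 := by funext i; simp [_root_.restrict]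
    rw [h0]
    simp only [Matrix.mulVec_zero, Pi.zero_apply, mul_zero, Finset.sum_const_zero, neg_zero,
      Finset.sum_empty, zero_div, add_zero]
    positivity
  | succ r ih =>
    intro R hr hd M hM hb
    by_cases hRe : R = ∅
    · exact ih R (by simp [hRe]) hd M hM hb
    obtain ⟨B, hBR, hBc, hor, M', hM', hb', hsM⟩ := exists_block h R s
    have hBpos : 0 < B.card := by
      rcases hor with h1 | h1
      · rw [h1]; exact Finset.card_pos.mpr (Finset.nonempty_iff_ne_empty.mpr hRe)
      · omega
    have hcard : (R \ B).card ≤ r := by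
      rw [Finset.card_sdiff_of_subset hBR]; omega
    have i1 := ih (R \ B) hcard (hd.mono_right Finset.sdiff_subset) M' hM' hb'
    have i2 := ro_bound A K δ hR v (restrict h B) V B hv
      (fun i hi => by simp [_root_.restrict, hi]) (hd.mono_right hBR) (by omega)
    rw [restrict_sq] at i2
    have hB2 : Real.sqrt (∑ i ∈ B, h i ^ 2) ≤ Real.sqrt s * M := by
      rw [Real.sqrt_le_left (by positivity), mul_pow, hs2]
      have := Finset.sum_le_card_nsmul B (fun i => h i ^ 2) (M ^ 2) (fun i hi => by
        rw [← sq_abs]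
        exact pow_le_pow_left₀ (abs_nonneg _) (hb i (hBR hi)) 2)
      rw [nsmul_eq_mul] at this
      refine this.trans ?_
      gcongr
    have hsum : ∑ i ∈ R, |h i| = ∑ i ∈ B, |h i| + ∑ i ∈ R \ B, |h i| := by
      rw [add_comm, Finset.sum_sdiff hBR]
    have hM2 : Real.sqrt s * M' ≤ (∑ i ∈ B, |h i|) / Real.sqrt s := by
      rw [le_div_iff₀ hsq]
      nlinarith
    have hspl : ∑ j, A.mulVec v j * A.mulVec (restrict h R) j =
        ∑ j, A.mulVec v j * A.mulVec (restrict h B) j +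
        ∑ j, A.mulVec v j * A.mulVec (restrict h (R \ B)) j := by
      rw [restrict_split h R B hBR, Matrix.mulVec_add, ← Finset.sum_add_distrib]
      refine Finset.sum_congr rfl fun i _ => ?_
      simp only [Pi.add_apply]; ring
    rw [hspl, hsum, add_div]
    have j2 := mul_le_mul_of_nonneg_left hB2 hδP
    have j1 := mul_le_mul_of_nonneg_left hM2 hδP
    linarith

lemma main_zero {m n : ℕ} (A : Matrix (Fin m) (Fin n) ℝ) (s : ℕ) (δ : ℝ) (hδ : 0 ≤ δ)
    (hδ2 : δ < 1 / 2) (hR : RIPineq A (3 * s) δ) (h : Fin n → ℝ) (hA : A.mulVec h = 0)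
    (S D : Finset (Fin n)) (hDS : D ⊆ S) (hS : S.card ≤ s)
    (hcone : ∑ i ∈ Sᶜ, |h i| ≤ ∑ i ∈ D, |h i|) : h = 0 := by
  have hfin : (∀ i ∈ S, h i = 0) → h = 0 := by
    intro h0
    have : ∑ i ∈ D, |h i| = 0 :=
      Finset.sum_eq_zero fun i hi => by rw [h0 i (hDS hi), abs_zero]
    rw [this] at hcone
    have h1 := (Finset.sum_eq_zero_iff_of_nonneg (fun i _ => abs_nonneg (h i))).mp
      (le_antisymm hcone (Finset.sum_nonneg fun i _ => abs_nonneg _))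
    funext i
    by_cases hi : i ∈ S
    · exact h0 i hi
    · exact abs_eq_zero.mp (h1 i (Finset.mem_compl.mpr hi))
  rcases Nat.eq_zero_or_pos s with hs | hs
  · have : S = ∅ := Finset.card_eq_zero.mp (by omega)
    exact hfin (by simp [this])
  obtain ⟨B, hBR, hBc, hor, M, hM, hb, hsM⟩ := exists_block h Sᶜ s
  have hs0 : (0 : ℝ) < s := by exact_mod_cast hs
  have hsq := Real.sqrt_pos.mpr hs0
  have hs2 := Real.sq_sqrt hs0.le
  have hVc : (S ∪ B).card ≤ 2 * s := (Finset.card_union_le _ _).trans (by omega)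
  have hcompl : univ \ (S ∪ B) = Sᶜ \ B := by
    ext i; simp
  have hv : ∀ i, i ∉ S ∪ B → restrict h (S ∪ B) i = 0 := fun i hi => by
    simp only [_root_.restrict, if_neg hi]
  have ht := tail_bound A (3 * s) s δ hδ hs hR (restrict h (S ∪ B)) h (S ∪ B) hv (by omega)
    _ (Sᶜ \ B) le_rfl (by rw [← hcompl]; exact Finset.disjoint_sdiff) M hM hb
  have hr := (hR (restrict h (S ∪ B)) ((norm0_le_of_supp _ _ hv).trans (by omega))).1
  have hsplit : h = restrict h (S ∪ B) + restrict h (Sᶜ \ B) := by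
    rw [← hcompl, ← restrict_split h univ (S ∪ B) (Finset.subset_univ _)]
    funext i; simp [_root_.restrict]
  have hAs : ∀ j, A.mulVec (restrict h (Sᶜ \ B)) j = - A.mulVec (restrict h (S ∪ B)) j := by
    intro j
    have := congrFun hA j
    rw [hsplit, Matrix.mulVec_add] at this
    simp only [Pi.add_apply, Pi.zero_apply] at this
    linarith
  simp only [hAs, mul_neg, Finset.sum_neg_distrib, neg_neg] at ht
  rw [restrict_sq] at ht hr
  have hp : 0 ≤ ∑ i ∈ S ∪ B, h i ^ 2 := Finset.sum_nonneg fun i _ => sq_nonneg _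
  have hP := Real.sqrt_nonneg (∑ i ∈ S ∪ B, h i ^ 2)
  have hP2 := Real.sq_sqrt hp
  have hD : ∑ i ∈ D, |h i| ≤ Real.sqrt s * Real.sqrt (∑ i ∈ S ∪ B, h i ^ 2) := by
    refine abs_le_of_sq_le_sq' ?_ (by positivity) |>.2
    rw [mul_pow, hP2, hs2]
    have h1 := sq_sum_le_card_mul_sum_sq (s := D) (f := fun i => |h i|)
    refine h1.trans ?_
    have h2 : ∑ i ∈ D, |h i| ^ 2 ≤ ∑ i ∈ S ∪ B, h i ^ 2 := by
      simp only [sq_abs]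
      exact Finset.sum_le_sum_of_subset_of_nonneg
        (hDS.trans Finset.subset_union_left) fun i _ _ => sq_nonneg _
    have h3 : (D.card : ℝ) ≤ s := by
      exact_mod_cast (Finset.card_le_card hDS).trans hS
    exact mul_le_mul h3 h2 (Finset.sum_nonneg fun i _ => sq_nonneg _) hs0.le
  have hsum : ∑ i ∈ Sᶜ, |h i| = ∑ i ∈ B, |h i| + ∑ i ∈ Sᶜ \ B, |h i| := by
    rw [add_comm, Finset.sum_sdiff hBR]
  set P := Real.sqrt (∑ i ∈ S ∪ B, h i ^ 2) with hPdef
  have hfac : Real.sqrt s * M + (∑ i ∈ Sᶜ \ B, |h i|) / Real.sqrt s ≤ P := by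
    have e : Real.sqrt s * M + (∑ i ∈ Sᶜ \ B, |h i|) / Real.sqrt s =
        (s * M + ∑ i ∈ Sᶜ \ B, |h i|) / Real.sqrt s := by
      rw [eq_div_iff hsq.ne', add_mul, div_mul_cancel₀ _ hsq.ne']
      linear_combination M * hs2
    rw [e, div_le_iff₀ hsq]
    linarith
  have hj := mul_le_mul_of_nonneg_left hfac (mul_nonneg hδ hP)
  simp only [← pow_two] at ht
  rw [← hP2] at hr
  have hPz : P ^ 2 ≤ 0 := by
    by_contra hcon
    push Not at hcon
    nlinarith
  rw [hP2] at hPz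
  have hz := (Finset.sum_eq_zero_iff_of_nonneg (fun i _ => sq_nonneg (h i))).mp
    (le_antisymm hPz hp)
  exact hfin fun i hi => by
    simpa using hz i (Finset.mem_union_left _ hi)

theorem stmt_12 {m n : ℕ} (A : Matrix (Fin m) (Fin n) ℝ) (hmn : m < n)
    (x : Fin n → ℝ) (N T Δ : Finset (Fin n)) (k u : ℕ)
    (hsupp : ∀ i, i ∉ N → x i = 0)
    (hTk : T.card = k) (hΔdef : Δ = Tᶜ ∩ N) (hΔu : Δ.card = u)
    (y : Fin m → ℝ) (hy : y = A.mulVec x)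
    (huk : u ≤ k)
    (δ : ℝ) (hδ : δ < Real.sqrt 2 / (1 + 2 * Real.sqrt 2))
    (hRIP : RIPineq A (3 * (k + u)) δ) :
    ∀ z : Fin n → ℝ, A.mulVec z = y → z ≠ x →
      norm1 (restrict x Tᶜ) < norm1 (restrict z Tᶜ) := by
  intro z hz hne
  by_contra hcon
  push Not at hcon
  apply hne
  have hδ' : δ < 1 / 2 := by
    refine hδ.trans ?_
    have := Real.sqrt_nonneg 2
    rw [div_lt_iff₀ (by positivity)]
    linarith
  have hR' : RIPineq A (3 * (k + u)) (max δ 0) := by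
    intro w hw
    have hq : 0 ≤ ∑ i, w i ^ 2 := Finset.sum_nonneg fun i _ => sq_nonneg _
    have hm := mul_le_mul_of_nonneg_right (le_max_left δ 0) hq
    obtain ⟨h1, h2⟩ := hRIP w hw
    constructor <;> linarith
  have hn : ∀ w : Fin n → ℝ, norm1 (restrict w Tᶜ) =
      ∑ i ∈ Tᶜ \ Δ, |w i| + ∑ i ∈ Δ, |w i| := by
    intro w
    rw [Finset.sum_sdiff (by rw [hΔdef]; exact Finset.inter_subset_left)]
    unfold norm1 _root_.restrict
    simp only [apply_ite abs, abs_zero]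
    rw [Finset.sum_ite_mem, Finset.univ_inter]
  have hSc : (T ∪ Δ)ᶜ = Tᶜ \ Δ := by
    ext i; simp
  have hx0 : ∀ i ∈ Tᶜ \ Δ, x i = 0 := by
    intro i hi
    apply hsupp
    intro hN
    rw [Finset.mem_sdiff] at hi
    apply hi.2
    rw [hΔdef]
    exact Finset.mem_inter.mpr ⟨hi.1, hN⟩
  have h0 : z - x = 0 := by
    refine main_zero A (k + u) (max δ 0) (le_max_right _ _) (max_lt hδ' (by norm_num)) hR'
      (z - x) ?_ (T ∪ Δ) Δ Finset.subset_union_right ?_ ?_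
    · rw [Matrix.mulVec_sub, hz, hy, sub_self]
    · exact (Finset.card_union_le _ _).trans (by omega)
    · rw [hSc]
      rw [hn, hn] at hcon
      have e1 : ∑ i ∈ Tᶜ \ Δ, |x i| = 0 :=
        Finset.sum_eq_zero fun i hi => by rw [hx0 i hi, abs_zero]
      have e2 : ∑ i ∈ Tᶜ \ Δ, |(z - x) i| = ∑ i ∈ Tᶜ \ Δ, |z i| :=
        Finset.sum_congr rfl fun i hi => by rw [Pi.sub_apply, hx0 i hi, sub_zero]
      have e3 : ∑ i ∈ Δ, |x i| ≤ ∑ i ∈ Δ, |z i| + ∑ i ∈ Δ, |(z - x) i| := by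
        rw [← Finset.sum_add_distrib]
        refine Finset.sum_le_sum fun i _ => ?_
        have := abs_sub (z i) (z i - x i)
        rw [sub_sub_cancel] at this
        exact this
      rw [e2]
      linarith
  exact sub_eq_zero.mp h0
end
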